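/- Let K ⊆ ℝⁿ be a nonempty compact convex set and F : K → ℝⁿ a continuous map. Then the variational inequality VI(K, F) has a solution, i.e., there exists x* ∈ K such that (x − x*)ᵀ F(x*) ≥ 0 for all x ∈ K. -/

import Mathlib

open scoped RealInnerProductSpace

section VIaux

variable {n : ℕ}

lemma vi_proj (K : Set (EuclideanSpace ℝ (Fin n)))
    (hne : K.Nonempty) (hcl : IsClosed K) (hconv : Convex ℝ K) :
    ∃ p : EuclideanSpace ℝ (Fin n) → EuclideanSpace ℝ (Fin n),
      (∀ x, p x ∈ K) ∧ (∀ x, ∀ w ∈ K, ⟪x - p x, w - p x⟫ ≤ 0) ∧ LipschitzWith 1 p := by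
  have h := exists_norm_eq_iInf_of_complete_convex hne hcl.isComplete hconv
  choose p hp hp2 using h
  have hp3 : ∀ x, ∀ w ∈ K, ⟪x - p x, w - p x⟫ ≤ 0 := fun x =>
    (norm_eq_iInf_iff_real_inner_le_zero hconv (hp x)).1 (hp2 x)
  refine ⟨p, hp, hp3, LipschitzWith.of_dist_le_mul fun x y => ?_⟩
  rw [dist_eq_norm, dist_eq_norm, NNReal.coe_one, one_mul]
  have h1 := hp3 x _ (hp y)
  have h2 := hp3 y _ (hp x)
  have h3 : ⟪p x - p y, p x - p y⟫ ≤ ⟪x - y, p x - p y⟫ := by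
    have e1 : ⟪x - p x, p y - p x⟫ = -⟪x, p x - p y⟫ + ⟪p x, p x - p y⟫ := by
      simp only [inner_sub_left, inner_sub_right]; ring
    have e2 : ⟪y - p y, p x - p y⟫ = ⟪y, p x - p y⟫ - ⟪p y, p x - p y⟫ := by
      simp only [inner_sub_left]
    rw [inner_sub_left, inner_sub_left]
    linarith
  have h4 := real_inner_le_norm (x - y) (p x - p y)
  rw [real_inner_self_eq_norm_mul_norm] at h3
  by_contra! hc
  have : 0 ≤ ‖x - y‖ := norm_nonneg _
  nlinarith

lemma vi_interp (s : Fin (n + 1) → ℝ) (hs : Function.Injective s) :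
    ∃ c : Fin (n + 1) → ℝ, ∑ i, c i = 1 ∧
      ∀ A : EuclideanSpace ℝ (Fin n) →L[ℝ] EuclideanSpace ℝ (Fin n),
        (ContinuousLinearMap.id ℝ _ + A).det =
          ∑ i, c i * (ContinuousLinearMap.id ℝ _ + s i • A).det := by
  refine ⟨fun i => (Lagrange.basis Finset.univ s i).eval 1, ?_, fun A => ?_⟩
  · have := Lagrange.sum_basis (s := Finset.univ) (v := s) hs.injOn Finset.univ_nonempty
    have := congrArg (Polynomial.eval 1) this
    simpa [Polynomial.eval_finsetSum] using this
  · let b := (EuclideanSpace.basisFun (Fin n) ℝ).toBasis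
    let M := LinearMap.toMatrix b b (A : EuclideanSpace ℝ (Fin n) →ₗ[ℝ] EuclideanSpace ℝ (Fin n))
    let P : Polynomial ℝ := Matrix.det ((Polynomial.X : Polynomial ℝ) • M.map Polynomial.C +
      (1 : Matrix (Fin n) (Fin n) ℝ).map Polynomial.C)
    have hP : ∀ t : ℝ, (ContinuousLinearMap.id ℝ _ + t • A).det = P.eval t := by
      intro t
      rw [ContinuousLinearMap.det, ← LinearMap.det_toMatrix b]
      simp only [P]
      rw [← Polynomial.coe_evalRingHom, RingHom.map_det]
      congr 1
      ext i j
      simp [M, Matrix.one_apply, add_comm]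
      split_ifs <;> simp [mul_comm]
    have hdeg : P.degree < (Finset.univ : Finset (Fin (n+1))).card := by
      have := Polynomial.natDegree_det_X_add_C_le M 1
      simp only [Fintype.card_fin] at this
      refine lt_of_le_of_lt Polynomial.degree_le_natDegree ?_
      simp only [Finset.card_univ, Fintype.card_fin]
      exact_mod_cast Nat.lt_succ_of_le this
    have := Lagrange.eq_interpolate (s := Finset.univ) (v := s) hs.injOn hdeg
    have h1 := hP 1
    rw [one_smul] at h1
    rw [h1, this, Lagrange.interpolate_apply, Polynomial.eval_finsetSum]
    refine Finset.sum_congr rfl fun i _ => ?_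
    rw [hP, Polynomial.eval_mul, Polynomial.eval_C, mul_comm]

open MeasureTheory Metric in
lemma vi_small (R : ℝ) (hR : 0 < R)
    (g : EuclideanSpace ℝ (Fin n) → EuclideanSpace ℝ (Fin n)) (hg : ContDiff ℝ 1 g)
    (h2 : ∀ x, ‖x‖ = R → g x = 0) (h3 : ∀ x, ‖x + g x‖ = R) :
    ∃ ε > 0, ∀ t : ℝ, 0 < t → t < ε →
      ∫ x in closedBall (0 : EuclideanSpace ℝ (Fin n)) R,
        (ContinuousLinearMap.id ℝ _ + t • fderiv ℝ g x).det =
        volume.real (closedBall (0 : EuclideanSpace ℝ (Fin n)) R) := by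
  set B := closedBall (0 : EuclideanSpace ℝ (Fin n)) R
  have hBc : IsCompact B := isCompact_closedBall _ _
  have hBconv : Convex ℝ B := convex_closedBall _ _
  have hfc : Continuous (fderiv ℝ g) := hg.continuous_fderiv (by norm_num)
  have hgd : Differentiable ℝ g := hg.differentiable (by norm_num)
  obtain ⟨C0, hC0⟩ := hBc.exists_bound_of_continuousOn hfc.continuousOn
  set C : NNReal := Real.toNNReal C0
  have hC : ∀ x ∈ B, ‖fderiv ℝ g x‖ ≤ C := fun x hx => (hC0 x hx).trans (Real.le_coe_toNNReal _)
  have hlip : LipschitzOnWith C g B :=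
    hBconv.lipschitzOnWith_of_nnnorm_fderiv_le (𝕜 := ℝ) (fun x _ => hgd x) (fun x hx => hC x hx)
  obtain ⟨p, hpB, hpi, hpl⟩ := vi_proj B ⟨0, by simp [B, hR.le]⟩ isClosed_closedBall hBconv
  -- positivity of the determinant near the identity
  have hdet : ∃ δ > 0, ∀ A : EuclideanSpace ℝ (Fin n) →L[ℝ] EuclideanSpace ℝ (Fin n),
      ‖A‖ < δ → 0 < (ContinuousLinearMap.id ℝ _ + A).det := by
    have hc : Continuous fun A : EuclideanSpace ℝ (Fin n) →L[ℝ] EuclideanSpace ℝ (Fin n) =>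
        (ContinuousLinearMap.id ℝ _ + A).det :=
      ContinuousLinearMap.continuous_det.comp (continuous_const.add continuous_id)
    have h0 : ∀ᶠ A in nhds (0 : EuclideanSpace ℝ (Fin n) →L[ℝ] EuclideanSpace ℝ (Fin n)),
        0 < (ContinuousLinearMap.id ℝ _ + A).det := by
      refine hc.continuousAt.eventually_const_lt ?_
      simp [ContinuousLinearMap.det]
    obtain ⟨δ, hδ, h⟩ := Metric.eventually_nhds_iff.1 h0
    exact ⟨δ, hδ, fun A hA => h (by simpa using hA)⟩
  obtain ⟨δ, hδ, hdet⟩ := hdet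
  have hC1 : (0 : ℝ) < C + 1 := by positivity
  refine ⟨min 1 (min 1 δ / (C + 1)), by positivity, fun t ht0 ht => ?_⟩
  have ht1 : t < 1 := ht.trans_le (min_le_left _ _)
  have ht' : t * (C + 1) < min 1 δ := by
    rw [← lt_div_iff₀ hC1]; exact ht.trans_le (min_le_right _ _)
  have htC : t * C < 1 := by have := ht'.trans_le (min_le_left _ _); nlinarith
  have htδ : t * C < δ := by have := ht'.trans_le (min_le_right _ _); nlinarith
  set f : EuclideanSpace ℝ (Fin n) → EuclideanSpace ℝ (Fin n) := fun x => x + t • g x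
  have hf' : ∀ x ∈ B, HasFDerivWithinAt f
      (ContinuousLinearMap.id ℝ _ + t • fderiv ℝ g x) B x := fun x _ =>
    ((hasFDerivAt_id x).add ((hgd x).hasFDerivAt.const_smul t)).hasFDerivWithinAt
  have hinj : Set.InjOn f B := by
    intro x hx y hy hxy
    have h : x - y = t • (g y - g x) := by
      have : x + t • g x = y + t • g y := hxy
      rw [smul_sub, sub_eq_sub_iff_add_eq_add, this, add_comm]
    have hn : ‖x - y‖ ≤ t * (C * ‖x - y‖) := by
      have h5 := hlip.norm_sub_le hx hy
      rw [norm_sub_rev] at h5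
      calc ‖x - y‖ = t * ‖g y - g x‖ := by rw [h, norm_smul, Real.norm_of_nonneg ht0.le]
        _ ≤ _ := by gcongr
    by_contra hne
    have : 0 < ‖x - y‖ := norm_pos_iff.2 (sub_ne_zero.2 hne)
    nlinarith
  have himg : f '' B = B := by
    apply Set.Subset.antisymm
    · rintro _ ⟨x, hx, rfl⟩
      have e : f x = (1 - t) • x + t • (x + g x) := by
        simp only [f, smul_add, sub_smul, one_smul]; abel
      rw [e]
      exact hBconv hx (by simp [B, h3]) (by linarith) ht0.le (by ring)
    · intro y hy
      have hcl : LipschitzWith (C * 1) (g ∘ p) := by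
        rw [← lipschitzOnWith_univ]
        exact hlip.comp hpl.lipschitzOnWith (fun x _ => hpB x)
      have hT : ContractingWith (Real.toNNReal (t * C)) (fun x => y - t • g (p x)) := by
        refine ⟨by rw [Real.toNNReal_lt_one]; exact htC, LipschitzWith.of_dist_le_mul fun a b => ?_⟩
        rw [Real.coe_toNNReal _ (by positivity), dist_sub_left, dist_smul₀,
          Real.norm_of_nonneg ht0.le, mul_assoc]
        have := hcl.dist_le_mul a b
        simp only [mul_one, Function.comp] at this
        gcongr
      have hx := hT.fixedPoint_isFixedPt
      set x := hT.fixedPoint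
      have hx : y - t • g (p x) = x := hx
      have hpx : p x = x := by
        by_cases hb : ‖p x‖ = R
        · rw [h2 _ hb] at hx
          have hyx : y = x := by simpa using hx
          have := hpi x x (hyx ▸ hy)
          rw [real_inner_self_nonpos] at this
          exact (sub_eq_zero.1 this).symm
        · have hlt : ‖p x‖ < R := lt_of_le_of_ne (by simpa [B] using hpB x) hb
          by_contra hne
          have hpos : 0 < ‖x - p x‖ := norm_pos_iff.2 (sub_ne_zero.2 (Ne.symm hne))
          set e := (R - ‖p x‖) / ‖x - p x‖
          have he : 0 < e := div_pos (by linarith) hpos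
          have := hpi x (p x + e • (x - p x)) (by
            simp only [B, mem_closedBall, dist_zero_right]
            refine (norm_add_le _ _).trans ?_
            rw [norm_smul, Real.norm_of_nonneg he.le, div_mul_cancel₀ _ hpos.ne']
            linarith)
          rw [add_sub_cancel_left, inner_smul_right, real_inner_self_eq_norm_mul_norm] at this
          have : 0 < e * (‖x - p x‖ * ‖x - p x‖) := by positivity
          linarith
      refine ⟨x, hpx ▸ hpB x, ?_⟩
      simp only [f]
      rw [hpx] at hx
      nth_rewrite 1 [← hx]
      exact sub_add_cancel _ _
  have key := integral_image_eq_integral_abs_det_fderiv_smul volume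
    (hBc.measurableSet) hf' hinj (fun _ => (1 : ℝ))
  rw [himg] at key
  simp only [smul_eq_mul, mul_one, integral_const, MeasurableSet.univ,
    measureReal_restrict_apply, Set.univ_inter] at key
  rw [key]
  refine setIntegral_congr_fun hBc.measurableSet fun x hx => ?_
  refine (abs_of_pos (hdet _ ?_)).symm
  rw [norm_smul, Real.norm_of_nonneg ht0.le]
  exact lt_of_le_of_lt (by gcongr; exact hC x hx) htδ

open MeasureTheory Metric in
lemma vi_no_retract (R : ℝ) (hR : 0 < R)
    (r : EuclideanSpace ℝ (Fin n) → EuclideanSpace ℝ (Fin n)) (hr : ContDiff ℝ 1 r)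
    (h2 : ∀ x, ‖x‖ = R → r x = x) (h3 : ∀ x, ‖r x‖ = R) : False := by
  set g := fun x => r x - x
  have hg : ContDiff ℝ 1 g := hr.sub contDiff_id
  have hfc : Continuous (fderiv ℝ g) := hg.continuous_fderiv (by norm_num)
  obtain ⟨ε, hε, hint⟩ := vi_small R hR g hg (fun x hx => by simp [g, h2 x hx])
    (fun x => by simp [g, h3])
  set s : Fin (n + 1) → ℝ := fun i => ε / ((i : ℕ) + 2)
  have hs : Function.Injective s := by
    intro i j hij
    simp only [s] at hij
    rw [div_eq_div_iff (by positivity) (by positivity)] at hij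
    have := mul_left_cancel₀ hε.ne' hij
    have : ((j : ℕ) : ℝ) = (i : ℕ) := by linarith
    exact Fin.ext (by exact_mod_cast this.symm)
  obtain ⟨c, hc1, hc⟩ := vi_interp s hs
  have hzero : ∀ x, (ContinuousLinearMap.id ℝ _ + fderiv ℝ g x).det = 0 := by
    intro x
    have hrd : HasFDerivAt r (fderiv ℝ r x) x := (hr.differentiable (by norm_num) x).hasFDerivAt
    have hgx : fderiv ℝ g x = fderiv ℝ r x - ContinuousLinearMap.id ℝ _ :=
      (hrd.sub (hasFDerivAt_id x)).fderiv
    rw [hgx, add_sub_cancel]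
    by_contra hne
    have hsurj : Function.Surjective (fderiv ℝ r x) := by
      exact (LinearMap.equivOfDetNeZero _ hne).surjective
    obtain ⟨v, hv⟩ := hsurj (r x)
    have h := hrd.norm_sq
    have h' : HasFDerivAt (fun y => ‖r y‖ ^ 2) (0 : EuclideanSpace ℝ (Fin n) →L[ℝ] ℝ) x := by
      simp only [h3]; exact hasFDerivAt_const _ _
    have := congrArg (fun L => L v) (h.unique h')
    simp [hv, h3] at this
    exact hR.ne' this
  have hci : ∀ i, IntegrableOn (fun x => (ContinuousLinearMap.id ℝ _ + s i • fderiv ℝ g x).det)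
      (closedBall (0 : EuclideanSpace ℝ (Fin n)) R) := by
    intro i
    refine ContinuousOn.integrableOn_compact (isCompact_closedBall _ _) (Continuous.continuousOn ?_)
    exact ContinuousLinearMap.continuous_det.comp
      (continuous_const.add (hfc.const_smul (s i)))
  have h0 : ∫ x in closedBall (0 : EuclideanSpace ℝ (Fin n)) R,
        (ContinuousLinearMap.id ℝ _ + fderiv ℝ g x).det = 0 := by
    simp [hzero]
  have hfun : (fun x : EuclideanSpace ℝ (Fin n) => (ContinuousLinearMap.id ℝ _ + fderiv ℝ g x).det) = fun x =>
    ∑ i, c i * (ContinuousLinearMap.id ℝ _ + s i • fderiv ℝ g x).det :=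
    funext fun x => hc _
  rw [hfun] at h0
  rw [integral_finsetSum _ (fun i _ => (hci i).const_mul (c i))] at h0
  simp_rw [integral_const_mul] at h0
  have h1 : ∀ i, ∫ x in closedBall (0 : EuclideanSpace ℝ (Fin n)) R,
        (ContinuousLinearMap.id ℝ _ + s i • fderiv ℝ g x).det =
        volume.real (closedBall (0 : EuclideanSpace ℝ (Fin n)) R) := by
    intro i
    refine hint _ (by positivity) ?_
    refine div_lt_self hε ?_
    have : (0 : ℝ) ≤ (i : ℕ) := by positivity
    linarith
  simp_rw [h1] at h0
  rw [← Finset.sum_mul, hc1, one_mul] at h0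
  have hpos : 0 < volume.real (closedBall (0 : EuclideanSpace ℝ (Fin n)) R) := by
    rw [measureReal_def]
    exact ENNReal.toReal_pos (measure_closedBall_pos _ _ hR).ne' measure_closedBall_lt_top.ne
  linarith

lemma vi_zero (b : EuclideanSpace ℝ (Fin n) → EuclideanSpace ℝ (Fin n)) (hb : Continuous b)
    (M : ℝ) (hM : ∀ x, ‖b x‖ ≤ M) : ∃ x, x + b x = 0 := by
  by_contra! hne
  have hM0 : 0 ≤ M := (norm_nonneg _).trans (hM 0)
  set c : EuclideanSpace ℝ (Fin n) → ℝ := fun x => max 0 (min 1 (M + 2 - ‖x‖))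
  have hc : Continuous c := by fun_prop
  have hc0 : ∀ x, 0 ≤ c x := fun x => le_max_left _ _
  have hc1 : ∀ x, c x ≤ 1 := fun x => max_le zero_le_one (min_le_left _ _)
  have hnz : ∀ x, x + c x • b x ≠ 0 := by
    intro x hx
    by_cases h : ‖x‖ ≤ M + 1
    · have : c x = 1 := by
        simp only [c]
        rw [min_eq_left (by linarith), max_eq_right zero_le_one]
      rw [this, one_smul] at hx
      exact hne x hx
    · have h1 : ‖x‖ = ‖c x • b x‖ :=
        (congrArg norm (eq_neg_of_add_eq_zero_left hx)).trans (norm_neg _)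
      rw [norm_smul, Real.norm_of_nonneg (hc0 x)] at h1
      have := mul_le_mul (hc1 x) (hM x) (norm_nonneg _) zero_le_one
      linarith
  obtain ⟨g, hg, hga, hgs⟩ := Continuous.exists_contDiff_approx (f := fun x => c x • b x)
    (ε := fun x => ‖x + c x • b x‖) 1 (by fun_prop) (by fun_prop)
    (fun x => norm_pos_iff.2 (hnz x))
  have hh : ∀ x, x + g x ≠ 0 := by
    intro x hx
    have := hga x
    rw [eq_neg_of_add_eq_zero_right hx, dist_eq_norm, ← norm_neg] at this
    simp [add_comm] at this
  have hR : 0 < M + 2 := by linarith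
  have hhs : ContDiff ℝ 1 (fun x => x + g x) := contDiff_id.add hg
  refine vi_no_retract (M + 2) hR (fun x => ((M + 2) * ‖x + g x‖⁻¹) • (x + g x)) ?_ ?_ ?_
  · exact (contDiff_const.mul ((hhs.norm ℝ hh).inv (fun x => norm_ne_zero_iff.2 (hh x)))).smul hhs
  · intro x hx
    have : g x = 0 := by
      by_contra h
      have := hgs (Function.mem_support.2 h)
      simp [c, hx] at this
    simp only [this, add_zero, hx]
    rw [mul_inv_cancel₀ hR.ne', one_smul]
  · intro x
    rw [norm_smul, norm_mul, norm_inv, norm_norm, Real.norm_of_nonneg hR.le, mul_assoc,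
      inv_mul_cancel₀ (norm_ne_zero_iff.2 (hh x)), mul_one]

end VIaux

/-- Existence of a solution of the variational inequality VI(K, F) on a nonempty
compact convex set `K ⊆ ℝⁿ` with `F` continuous on `K`. -/
theorem stmt3 {n : ℕ} (K : Set (EuclideanSpace ℝ (Fin n)))
    (hne : K.Nonempty) (hcomp : IsCompact K) (hconv : Convex ℝ K)
    (F : EuclideanSpace ℝ (Fin n) → EuclideanSpace ℝ (Fin n))
    (hF : ContinuousOn F K) :
    ∃ xstar ∈ K, ∀ x ∈ K, 0 ≤ ⟪x - xstar, F xstar⟫ := by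
  obtain ⟨p, hpK, hpi, hpl⟩ := vi_proj K hne hcomp.isClosed hconv
  have hFp : Continuous fun x => F (p x) := hF.comp_continuous hpl.continuous hpK
  obtain ⟨M1, hM1⟩ := hcomp.exists_bound_of_continuousOn hF
  obtain ⟨M2, hM2⟩ := hcomp.exists_bound_of_continuousOn (continuousOn_id (s := K))
  obtain ⟨y, hy⟩ := vi_zero (fun x => F (p x) - p x) (hFp.sub hpl.continuous) (M1 + M2)
    (fun x => (norm_sub_le _ _).trans (add_le_add (hM1 _ (hpK x)) (hM2 _ (hpK x))))
  refine ⟨p y, hpK y, fun x hx => ?_⟩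
  have h := hpi y x hx
  have e : y - p y = - F (p y) := by
    rw [eq_neg_iff_add_eq_zero, ← hy]; abel
  rw [e, inner_neg_left, real_inner_comm] at h
  linarith
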